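/- For all points a, b ∈ EuclideanSpace ℝ (Fin 2), headings α, β ∈ ℝ, and every minimum turning radius r_min > 0, there exist s > 0 and a feasible trajectory (Λ, v) of length s from the oriented point (a, α) to the oriented point (b, β) which is a concatenation of at most three circular arcs: there exist 0 ≤ t1 ≤ t2 ≤ s, centres c1, c2, c3 ∈ EuclideanSpace ℝ (Fin 2) and radii ρ1, ρ2, ρ3 ≥ r_min such that dist (Λ t) c1 = ρ1 for all t ∈ [0, t1], dist (Λ t) c2 = ρ2 for all t ∈ [t1, t2], and dist (Λ t) c3 = ρ3 for all t ∈ [t2, s]. In particular, a curvature-bounded Circle-Circle-Circle trajectory with at most two changeover points exists between any two oriented points. -/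

import Mathlib

/-- The point of the Euclidean plane with coordinates `(x, y)`. -/
noncomputable def planePt (x y : ℝ) : EuclideanSpace ℝ (Fin 2) :=
  (WithLp.equiv 2 (Fin 2 → ℝ)).symm ![x, y]

/-- A feasible curvature-bounded trajectory of length `s` from the oriented point
`(a, α)` to the oriented point `(b, β)`: a unit-speed `C¹` path `Λ` with velocity `v`,
matching endpoints and headings, whose velocity is `(1/r_min)`-Lipschitz on `[0, s]`
(the curvature bound `‖Λ''‖ ≤ 1/r_min`). -/
def FeasibleTrajectory (a b : EuclideanSpace ℝ (Fin 2)) (α β : ℝ) (r_min s : ℝ)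
    (Λ v : ℝ → EuclideanSpace ℝ (Fin 2)) : Prop :=
  (∀ t ∈ Set.Icc (0 : ℝ) s, HasDerivAt Λ (v t) t) ∧
  (∀ t ∈ Set.Icc (0 : ℝ) s, ‖v t‖ = 1) ∧
  Λ 0 = a ∧ Λ s = b ∧
  v 0 = planePt (Real.cos α) (Real.sin α) ∧
  v s = planePt (Real.cos β) (Real.sin β) ∧
  LipschitzOnWith (1 / r_min).toNNReal v (Set.Icc (0 : ℝ) s)

/-- The unit vector with heading `θ`. -/
noncomputable def headingVec (θ : ℝ) : EuclideanSpace ℝ (Fin 2) :=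
  planePt (Real.cos θ) (Real.sin θ)

/-- The unit vector pointing to the right of the heading `θ`. -/
noncomputable def rightVec (θ : ℝ) : EuclideanSpace ℝ (Fin 2) :=
  planePt (Real.sin θ) (-Real.cos θ)

theorem hasDerivAt_planePt {f g : ℝ → ℝ} {f' g' x : ℝ} (hf : HasDerivAt f f' x)
    (hg : HasDerivAt g g' x) :
    HasDerivAt (fun t => planePt (f t) (g t)) (planePt f' g') x := by
  have h : HasDerivAt (fun t => ![f t, g t]) ![f', g'] x := by
    rw [hasDerivAt_pi]
    intro i
    fin_cases i
    · simpa using hf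
    · simpa using hg
  exact (PiLp.hasFDerivAt_toLp 2 _).comp_hasDerivAt x h

theorem norm_planePt (x y : ℝ) : ‖planePt x y‖ = Real.sqrt (x ^ 2 + y ^ 2) := by
  simp [planePt, EuclideanSpace.norm_eq]

theorem norm_headingVec (θ : ℝ) : ‖headingVec θ‖ = 1 := by
  simp [headingVec, norm_planePt]

theorem norm_rightVec (θ : ℝ) : ‖rightVec θ‖ = 1 := by
  simp [rightVec, norm_planePt]

theorem hasDerivAt_rightVec (θ : ℝ) : HasDerivAt rightVec (headingVec θ) θ := by
  have h := hasDerivAt_planePt (Real.hasDerivAt_sin θ) (Real.hasDerivAt_cos θ).neg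
  rwa [neg_neg] at h

theorem hasDerivAt_headingVec (θ : ℝ) : HasDerivAt headingVec (-rightVec θ) θ := by
  have h := hasDerivAt_planePt (Real.hasDerivAt_cos θ) (Real.hasDerivAt_sin θ)
  have h' : -rightVec θ = planePt (-Real.sin θ) (Real.cos θ) := by
    ext i
    fin_cases i <;> simp [rightVec, planePt]
  rwa [h']

theorem lipschitzWith_headingVec : LipschitzWith 1 headingVec :=
  lipschitzWith_of_nnnorm_deriv_le (fun θ => (hasDerivAt_headingVec θ).differentiableAt)
    fun θ => by
      rw [(hasDerivAt_headingVec θ).deriv, nnnorm_neg, ← NNReal.coe_le_coe]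
      simp [norm_rightVec]

theorem headingVec_add_two_pi_mul (θ : ℝ) (k : ℤ) :
    headingVec (θ + k * (2 * Real.pi)) = headingVec θ := by
  simp [headingVec]

theorem rightVec_add_two_pi_mul (θ : ℝ) (k : ℤ) :
    rightVec (θ + k * (2 * Real.pi)) = rightVec θ := by
  simp [rightVec]

theorem rightVec_add_pi (θ : ℝ) : rightVec (θ + Real.pi) = -rightVec θ := by
  ext i
  fin_cases i <;> simp [rightVec, planePt]

theorem exists_eq_smul_rightVec (w : EuclideanSpace ℝ (Fin 2)) :
    ∃ D φ : ℝ, 0 ≤ D ∧ w = D • rightVec φ := by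
  refine ⟨‖(⟨-w 1, w 0⟩ : ℂ)‖, Complex.arg ⟨-w 1, w 0⟩, norm_nonneg _, ?_⟩
  ext i
  fin_cases i
  · simp [rightVec, planePt, Complex.norm_mul_sin_arg]
  · simp [rightVec, planePt, Complex.norm_mul_cos_arg]

/-- Every angle can be moved past a given bound by adding full turns. -/
theorem exists_le_add_two_pi_mul (x y : ℝ) : ∃ k : ℤ, x ≤ y + k * (2 * Real.pi) := by
  obtain ⟨k, hk, -⟩ := existsUnique_add_zsmul_mem_Ico Real.two_pi_pos y x
  exact ⟨k, by simpa using hk.1⟩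

/-- The anticlockwise unit-speed parametrization of the circle with centre `c` and radius `ρ`
that has heading `φ` at time `τ`. -/
noncomputable def leftArc (c : EuclideanSpace ℝ (Fin 2)) (ρ φ τ t : ℝ) :
    EuclideanSpace ℝ (Fin 2) :=
  c + ρ • rightVec (φ + (t - τ) / ρ)

theorem hasDerivAt_leftArc (c : EuclideanSpace ℝ (Fin 2)) {ρ : ℝ} (hρ : 0 < ρ) (φ τ t : ℝ) :
    HasDerivAt (leftArc c ρ φ τ) (headingVec (φ + (t - τ) / ρ)) t := by
  have h : HasDerivAt (fun t : ℝ => φ + (t - τ) / ρ) (1 / ρ) t :=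
    (((hasDerivAt_id t).sub_const τ).div_const ρ).const_add φ
  have h₂ := (((hasDerivAt_rightVec _).scomp t h).const_smul ρ).const_add c
  rwa [smul_smul, mul_one_div_cancel hρ.ne', one_smul] at h₂

theorem dist_leftArc (c : EuclideanSpace ℝ (Fin 2)) {ρ : ℝ} (hρ : 0 < ρ) (φ τ t : ℝ) :
    dist (leftArc c ρ φ τ t) c = ρ := by
  simp [leftArc, norm_smul, norm_rightVec, hρ.le]

theorem lipschitzWith_headingVec_leftArc {r ρ : ℝ} (hr : 0 < r) (hρ : r ≤ ρ) (φ τ : ℝ) :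
    LipschitzWith (1 / r).toNNReal fun t => headingVec (φ + (t - τ) / ρ) := by
  refine LipschitzWith.of_dist_le_mul fun x y => ?_
  refine (lipschitzWith_headingVec.dist_le_mul _ _).trans ?_
  have h : φ + (x - τ) / ρ - (φ + (y - τ) / ρ) = 1 / ρ * (x - y) := by ring
  have hρ' : 0 < ρ := hr.trans_le hρ
  rw [Real.coe_toNNReal _ (by positivity), Real.dist_eq, Real.dist_eq, h, abs_mul,
    abs_of_pos (by positivity : 0 < 1 / ρ), NNReal.coe_one, one_mul]
  gcongr

section Concatenation

variable {E : Type*}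

/-- The map that follows `f` up to time `c` and `g` afterwards. -/
noncomputable def concatAt (c : ℝ) (f g : ℝ → E) (t : ℝ) : E :=
  if t ≤ c then f t else g t

theorem concatAt_of_le {c t : ℝ} (f g : ℝ → E) (h : t ≤ c) : concatAt c f g t = f t :=
  if_pos h

theorem concatAt_of_ge {c t : ℝ} {f g : ℝ → E} (hfg : f c = g c) (h : c ≤ t) :
    concatAt c f g t = g t := by
  rcases h.eq_or_lt with rfl | h
  · rw [concatAt_of_le _ _ le_rfl, hfg]
  · exact if_neg h.not_ge

theorem hasDerivAt_concatAt [NormedAddCommGroup E] [NormedSpace ℝ E] {c : ℝ}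
    {f g f' g' : ℝ → E} (hf : ∀ t, HasDerivAt f (f' t) t) (hg : ∀ t, HasDerivAt g (g' t) t)
    (hfg : f c = g c) (hfg' : f' c = g' c) (t : ℝ) :
    HasDerivAt (concatAt c f g) (concatAt c f' g' t) t := by
  rcases lt_trichotomy t c with h | rfl | h
  · rw [concatAt_of_le _ _ h.le]
    refine (hf t).congr_of_eventuallyEq ?_
    filter_upwards [Iio_mem_nhds h] with x hx using concatAt_of_le _ _ (le_of_lt hx)
  · rw [← hasDerivWithinAt_univ, ← Set.Iic_union_Ici (a := t)]
    refine HasDerivWithinAt.union ?_ ?_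
    · rw [concatAt_of_le _ _ le_rfl]
      exact (hf t).hasDerivWithinAt.congr (fun x hx => concatAt_of_le _ _ hx)
        (concatAt_of_le _ _ le_rfl)
    · rw [concatAt_of_ge hfg' le_rfl]
      exact (hg t).hasDerivWithinAt.congr (fun x hx => concatAt_of_ge hfg hx)
        (concatAt_of_ge hfg le_rfl)
  · rw [concatAt_of_ge hfg' h.le]
    refine (hg t).congr_of_eventuallyEq ?_
    filter_upwards [Ioi_mem_nhds h] with x hx using concatAt_of_ge hfg (le_of_lt hx)

theorem LipschitzWith.concatAt [PseudoMetricSpace E] {c : ℝ} {K : NNReal} {f g : ℝ → E}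
    (hf : LipschitzWith K f) (hg : LipschitzWith K g) (hfg : f c = g c) :
    LipschitzWith K (concatAt c f g) := by
  refine LipschitzWith.of_dist_le_mul fun x y => ?_
  wlog hxy : x ≤ y generalizing x y
  · rw [dist_comm, dist_comm x]
    exact this y x (le_of_not_ge hxy)
  rcases le_total y c with hy | hy
  · rw [concatAt_of_le _ _ hy, concatAt_of_le _ _ (hxy.trans hy)]
    exact hf.dist_le_mul x y
  rcases le_total c x with hx | hx
  · rw [concatAt_of_ge hfg hy, concatAt_of_ge hfg hx]
    exact hg.dist_le_mul x y
  rw [concatAt_of_le _ _ hx, concatAt_of_ge hfg hy]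
  have h₁ := hf.dist_le_mul x c
  have h₂ := hg.dist_le_mul c y
  have h₃ := dist_triangle (f x) (f c) (g y)
  rw [Real.dist_eq, abs_sub_comm, abs_of_nonneg (sub_nonneg.2 hx)] at h₁
  rw [Real.dist_eq, abs_sub_comm, abs_of_nonneg (sub_nonneg.2 hy)] at h₂
  rw [Real.dist_eq, abs_sub_comm, abs_of_nonneg (sub_nonneg.2 hxy)]
  rw [hfg] at h₁ h₃
  nlinarith

end Concatenation

/-- Between any two oriented points of the plane and for any minimum turning radius
`r_min > 0`, there exists a feasible curvature-bounded trajectory that is a concatenation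
of at most three circular arcs of radii at least `r_min` (a Circle-Circle-Circle
trajectory with at most two changeover points). -/
theorem exists_CCC_trajectory
    (a b : EuclideanSpace ℝ (Fin 2)) (α β : ℝ) (r_min : ℝ) (hr : 0 < r_min) :
    ∃ s > (0 : ℝ), ∃ Λ v : ℝ → EuclideanSpace ℝ (Fin 2),
      FeasibleTrajectory a b α β r_min s Λ v ∧
      ∃ t1 t2 : ℝ, 0 ≤ t1 ∧ t1 ≤ t2 ∧ t2 ≤ s ∧
        ∃ (c1 c2 c3 : EuclideanSpace ℝ (Fin 2)) (ρ1 ρ2 ρ3 : ℝ),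
          r_min ≤ ρ1 ∧ r_min ≤ ρ2 ∧ r_min ≤ ρ3 ∧
          (∀ t ∈ Set.Icc (0 : ℝ) t1, dist (Λ t) c1 = ρ1) ∧
          (∀ t ∈ Set.Icc t1 t2, dist (Λ t) c2 = ρ2) ∧
          (∀ t ∈ Set.Icc t2 s, dist (Λ t) c3 = ρ3) := by
  obtain ⟨D, φ₀, hD, hw⟩ := exists_eq_smul_rightVec
    ((a - r_min • rightVec α) - (b - r_min • rightVec β))
  obtain ⟨k, hk⟩ := exists_le_add_two_pi_mul α φ₀
  rw [← rightVec_add_two_pi_mul φ₀ k] at hw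
  generalize φ₀ + k * (2 * Real.pi) = φ at hw hk
  obtain ⟨l, hl⟩ := exists_le_add_two_pi_mul (φ + Real.pi) β
  -- Two circles of radius `r_min`, both internally tangent to a circle centred at the midpoint
  -- of their centres; the tangency points are antipodal on the large circle.
  set c₁ := a - r_min • rightVec α with hc₁
  set c₃ := b - r_min • rightVec β with hc₃
  set c₂ := c₁ - (D / 2) • rightVec φ with hc₂
  set ρ := r_min + D / 2 with hρ_def
  have hρr : r_min ≤ ρ := by linarith
  have hρ : 0 < ρ := hr.trans_le hρr
  set t₁ := r_min * (φ - α) with ht₁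
  set t₂ := t₁ + ρ * Real.pi with ht₂
  set s := t₂ + r_min * (β + l * (2 * Real.pi) - (φ + Real.pi)) with hs
  have h01 : 0 ≤ t₁ := mul_nonneg hr.le (sub_nonneg.2 hk)
  have hlt12 : t₁ < t₂ := lt_add_of_pos_right _ (mul_pos hρ Real.pi_pos)
  have h12 : t₁ ≤ t₂ := hlt12.le
  have h2s : t₂ ≤ s := le_add_of_nonneg_right (mul_nonneg hr.le (sub_nonneg.2 hl))
  have e₁ : α + (t₁ - 0) / r_min = φ := by rw [ht₁]; field_simp; ring
  have e₂ : φ + (t₂ - t₁) / ρ = φ + Real.pi := by rw [ht₂]; field_simp; ring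
  have e₃ : φ + Real.pi + (s - t₂) / r_min = β + l * (2 * Real.pi) := by
    rw [hs]; field_simp; ring
  set v₁ : ℝ → EuclideanSpace ℝ (Fin 2) := fun t => headingVec (α + (t - 0) / r_min) with hv₁
  set v₂ : ℝ → EuclideanSpace ℝ (Fin 2) := fun t => headingVec (φ + (t - t₁) / ρ) with hv₂
  set v₃ : ℝ → EuclideanSpace ℝ (Fin 2) :=
    fun t => headingVec (φ + Real.pi + (t - t₂) / r_min) with hv₃
  set A₁ := leftArc c₁ r_min α 0 with hA₁
  set A₂ := leftArc c₂ ρ φ t₁ with hA₂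
  set A₃ := leftArc c₃ r_min (φ + Real.pi) t₂ with hA₃
  have hv23 : v₂ t₂ = v₃ t₂ := by simp only [hv₂, hv₃, e₂, sub_self, zero_div, add_zero]
  have hv12 : v₁ t₁ = concatAt t₂ v₂ v₃ t₁ := by
    rw [concatAt_of_le _ _ h12]
    simp only [hv₁, hv₂, e₁, sub_self, zero_div, add_zero]
  have hA23 : A₂ t₂ = A₃ t₂ := by
    simp only [hA₂, hA₃, leftArc, e₂, sub_self, zero_div, add_zero, rightVec_add_pi]
    have h : c₁ = c₃ + D • rightVec φ := by rw [← hw]; abel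
    rw [hc₂, h, hρ_def]
    module
  have hA12 : A₁ t₁ = concatAt t₂ A₂ A₃ t₁ := by
    rw [concatAt_of_le _ _ h12]
    simp only [hA₁, hA₂, leftArc, e₁, sub_self, zero_div, add_zero]
    rw [hc₂, hρ_def]
    module
  have hΛ : ∀ t ∈ Set.Icc t₂ s, concatAt t₁ A₁ (concatAt t₂ A₂ A₃) t = A₃ t := fun t ht => by
    rw [concatAt_of_ge hA12 (h12.trans ht.1), concatAt_of_ge hA23 ht.1]
  have hV (t : ℝ) : ∃ θ, concatAt t₁ v₁ (concatAt t₂ v₂ v₃) t = headingVec θ := by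
    unfold concatAt
    split_ifs
    exacts [⟨_, rfl⟩, ⟨_, rfl⟩, ⟨_, rfl⟩]
  refine ⟨s, by linarith, concatAt t₁ A₁ (concatAt t₂ A₂ A₃),
    concatAt t₁ v₁ (concatAt t₂ v₂ v₃), ⟨fun t _ => ?_, fun t _ => ?_, ?_, ?_, ?_, ?_, ?_⟩,
    t₁, t₂, h01, h12, h2s, c₁, c₂, c₃, r_min, ρ, r_min, le_rfl, hρr, le_rfl,
    fun t ht => ?_, fun t ht => ?_, fun t ht => ?_⟩
  · exact hasDerivAt_concatAt (hasDerivAt_leftArc c₁ hr α 0)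
      (hasDerivAt_concatAt (hasDerivAt_leftArc c₂ hρ φ t₁)
        (hasDerivAt_leftArc c₃ hr (φ + Real.pi) t₂) hA23 hv23) hA12 hv12 t
  · obtain ⟨θ, hθ⟩ := hV t
    rw [hθ, norm_headingVec]
  · rw [concatAt_of_le _ _ h01]
    simp [hA₁, leftArc, hc₁]
  · rw [hΛ s ⟨h2s, le_rfl⟩]
    simp only [hA₃, leftArc, e₃, rightVec_add_two_pi_mul]
    rw [hc₃]
    abel
  · rw [concatAt_of_le _ _ h01]
    simp [hv₁, headingVec]
  · rw [concatAt_of_ge hv12 (h12.trans h2s), concatAt_of_ge hv23 h2s]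
    simp only [hv₃, e₃, headingVec_add_two_pi_mul]
    rfl
  · exact ((lipschitzWith_headingVec_leftArc hr le_rfl α 0).concatAt
      ((lipschitzWith_headingVec_leftArc hr hρr φ t₁).concatAt
        (lipschitzWith_headingVec_leftArc hr le_rfl _ t₂) hv23) hv12).lipschitzOnWith
  · rw [concatAt_of_le _ _ ht.2]
    exact dist_leftArc c₁ hr _ _ _
  · rw [concatAt_of_ge hA12 ht.1, concatAt_of_le _ _ ht.2]
    exact dist_leftArc c₂ hρ _ _ _
  · rw [hΛ t ht]
    exact dist_leftArc c₃ hr _ _ _
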